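/- arXiv:2412.05867 — 2 statements merged into one kernel-verified Lean document; each statement's English description precedes it below -/
import Mathlib

section
/- Let P be a finite set of rational primes and, for each p ∈ P, let α_p, β_p ∈ ℤ_p be algebraic over ℚ and not both zero. Then there exist constants d > 1/2 and s < 1/2 and a bound Q such that M(q, q^d) < q^s for every positive integer q > Q all of whose prime factors lie in P. -/
instance (p : Nat.Primes) : Fact (p : ℕ).Prime := ⟨p.2⟩

/-- `M(q, t)`: the number of pairs of rational integers `(u, v)` with
`uβ_p − vα_p ∈ qℤ_p` and `uβ_p − vα_p ≠ 0` for every `p ∈ P`, and `|u|, |v| ≤ t`. -/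
noncomputable def Mcount (P : Finset Nat.Primes) (α β : (p : Nat.Primes) → ℤ_[(p : ℕ)])
    (q : ℕ) (t : ℝ) : ℕ :=
  Set.ncard {uv : ℤ × ℤ |
    (∀ p ∈ P, (q : ℤ_[(p : ℕ)]) ∣
      ((uv.1 : ℤ_[(p : ℕ)]) * β p - (uv.2 : ℤ_[(p : ℕ)]) * α p)) ∧
    (∀ p ∈ P, (uv.1 : ℤ_[(p : ℕ)]) * β p - (uv.2 : ℤ_[(p : ℕ)]) * α p ≠ 0) ∧
    (|uv.1| : ℝ) ≤ t ∧ (|uv.2| : ℝ) ≤ t}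

theorem Algebra.dvd_algebraMap_norm {R S : Type*} [CommRing R] [CommRing S] [Algebra R S]
    [Nontrivial R] [Module.Free R S] [Module.Finite R S] (x : S) :
    x ∣ algebraMap R S (Algebra.norm R x) := by
  set f := Algebra.lmul R S x
  have h0 : Polynomial.aeval x f.charpoly = 0 := by
    have h := f.aeval_self_charpoly
    rw [Polynomial.aeval_algHom_apply] at h
    simpa using congrArg (fun g => g 1) h
  have h1 := map_dvd (Polynomial.aeval x) (Polynomial.X_dvd_sub_C (p := f.charpoly))
  rw [map_sub, h0, Polynomial.aeval_X, Polynomial.aeval_C, zero_sub, dvd_neg] at h1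
  rw [Algebra.norm_apply, LinearMap.det_eq_sign_charpoly_coeff, map_mul]
  exact h1.mul_left _

theorem exists_liouville_norm {R : Type*} [CommRing R] [IsDomain R] [CharZero R] {a b : R}
    (ha : IsAlgebraic ℤ a) (hb : IsAlgebraic ℤ b) :
    ∃ n C : ℕ, ∀ (u v : ℤ) (H : ℕ), u.natAbs ≤ H → v.natAbs ≤ H → (u : R) * b - v * a ≠ 0 →
      ∃ N : ℤ, N ≠ 0 ∧ N.natAbs ≤ C * H ^ n ∧ (u : R) * b - v * a ∣ (N : R) := by
  obtain ⟨k, hk, ha⟩ := ha.exists_integral_multiple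
  obtain ⟨l, hl, hb⟩ := hb.exists_integral_multiple
  have ha' : IsIntegral ℤ ((k * l) • a) := by
    rw [mul_comm, mul_smul]; exact ha.smul l
  have hb' : IsIntegral ℤ ((k * l) • b) := by
    rw [mul_smul]; exact hb.smul k
  have hm : k * l ≠ 0 := mul_ne_zero hk hl
  generalize k * l = m at *
  set A := Algebra.adjoin ℤ ({m • a, m • b} : Set R)
  have : Module.Finite ℤ A := by
    refine Module.Finite.iff_fg.mpr (fg_adjoin_of_finite (by simp) ?_)
    rintro x (rfl | rfl)
    exacts [ha', hb']
  have : Module.Free ℤ A := inferInstance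
  let a' : A := ⟨m • a, Algebra.subset_adjoin (by simp)⟩
  let b' : A := ⟨m • b, Algebra.subset_adjoin (by simp)⟩
  let B := Module.Free.chooseBasis ℤ A
  let M := Algebra.leftMulMatrix B
  let c : ℕ := ∑ i, ∑ j, ((M a' i j).natAbs + (M b' i j).natAbs)
  have hc (i j) : (M a' i j).natAbs + (M b' i j).natAbs ≤ c :=
    (Finset.single_le_sum (f := fun j => (M a' i j).natAbs + (M b' i j).natAbs)
      (fun _ _ => zero_le) (Finset.mem_univ j)).trans
    (Finset.single_le_sum (f := fun i => ∑ j, ((M a' i j).natAbs + (M b' i j).natAbs))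
      (fun _ _ => zero_le) (Finset.mem_univ i))
  refine ⟨Fintype.card (Module.Free.ChooseBasisIndex ℤ A),
    (Fintype.card (Module.Free.ChooseBasisIndex ℤ A)).factorial * c ^ Fintype.card (Module.Free.ChooseBasisIndex ℤ A), ?_⟩
  intro u v H hu hv hw
  let x : A := u • b' - v • a'
  have hx : (x : R) = m * ((u : R) * b - v * a) := by
    have : (x : R) = u • (m • b) - v • (m • a) := rfl
    rw [this]
    simp only [zsmul_eq_mul]
    ring
  have hx0 : x ≠ 0 := by
    intro h
    rw [h, ZeroMemClass.coe_zero, eq_comm, mul_eq_zero] at hx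
    simp [hm, hw] at hx
  refine ⟨Algebra.norm ℤ x, ?_, ?_, ?_⟩
  · rwa [Ne, Algebra.norm_eq_zero_iff_of_basis B]
  · rw [Algebra.norm_eq_matrix_det B]
    have hent (i j) : AbsoluteValue.abs (M x i j) ≤ ((c * H : ℕ) : ℤ) := by
      have h1 : M x i j = u * M b' i j - v * M a' i j := by
        have : M x = u • M b' - v • M a' := by simp only [x, map_sub, map_zsmul]
        simp [this, -zsmul_eq_mul]
      rw [h1, AbsoluteValue.abs_apply, Int.abs_eq_natAbs, Nat.cast_le]
      calc _ ≤ (u * M b' i j).natAbs + (v * M a' i j).natAbs := Int.natAbs_sub_le _ _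
        _ ≤ H * (M b' i j).natAbs + H * (M a' i j).natAbs := by
          rw [Int.natAbs_mul, Int.natAbs_mul]; gcongr
        _ = ((M a' i j).natAbs + (M b' i j).natAbs) * H := by ring
        _ ≤ _ := by gcongr; exact hc i j
    have h := Matrix.det_le hent
    rw [AbsoluteValue.abs_apply, Int.abs_eq_natAbs, nsmul_eq_mul] at h
    rw [mul_assoc, ← mul_pow]
    exact_mod_cast h
  · have h := map_dvd A.val (Algebra.dvd_algebraMap_norm (R := ℤ) x)
    simp only [Subalgebra.coe_val, hx] at h
    exact (Dvd.intro_left _ rfl).trans (by simpa using h)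

theorem Int.natCast_dvd_of_forall_padicInt_dvd {P : Finset Nat.Primes} {q : ℕ} {N : ℤ}
    (hq : ∀ l : Nat.Primes, (l : ℕ) ∣ q → l ∈ P)
    (h : ∀ p ∈ P, (q : ℤ_[(p : ℕ)]) ∣ (N : ℤ_[(p : ℕ)])) : (q : ℤ) ∣ N := by
  rw [Int.natCast_dvd, Nat.dvd_iff_prime_pow_dvd_dvd]
  intro p k hp hk
  rcases Nat.eq_zero_or_pos k with rfl | hk0
  · simp
  have : Fact p.Prime := ⟨hp⟩
  have h1 := h ⟨p, hp⟩ (hq ⟨p, hp⟩ ((dvd_pow_self p hk0.ne').trans hk))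
  rw [← Int.natCast_dvd, Nat.cast_pow, ← PadicInt.norm_int_le_pow_iff_dvd,
    PadicInt.norm_le_pow_iff_mem_span_pow, Ideal.mem_span_singleton, ← Nat.cast_pow]
  exact ((Nat.cast_dvd_cast hk).trans h1)

theorem PadicInt.exists_pos_dvd_natCast {p : ℕ} [Fact p.Prime] {x : ℤ_[p]} (hx : x ≠ 0) :
    ∃ D : ℕ, 0 < D ∧ x ∣ (D : ℤ_[p]) := by
  refine ⟨p ^ x.valuation, pow_pos (Fact.out (p := p.Prime)).pos _, ?_⟩
  have h := PadicInt.unitCoeff_spec hx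
  rw [Nat.cast_pow]
  conv_lhs => rw [h]
  exact (Units.mul_left_dvd).mpr dvd_rfl

/-- The larger absolute value of the two coordinates of an integral point of the plane. -/
def supHeight (x : ℤ × ℤ) : ℕ := max x.1.natAbs x.2.natAbs

/-- The determinant of two integral points of the plane. -/
def planeDet (x y : ℤ × ℤ) : ℤ := x.1 * y.2 - x.2 * y.1

theorem supHeight_zsmul (k : ℤ) (x : ℤ × ℤ) : supHeight (k • x) = k.natAbs * supHeight x := by
  simp [supHeight, Int.natAbs_mul, Nat.mul_max_mul_left]

theorem natAbs_planeDet_le (x y : ℤ × ℤ) :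
    (planeDet x y).natAbs ≤ 2 * supHeight x * supHeight y := by
  calc (planeDet x y).natAbs ≤ (x.1 * y.2).natAbs + (x.2 * y.1).natAbs := Int.natAbs_sub_le _ _
    _ ≤ supHeight x * supHeight y + supHeight x * supHeight y := by
      rw [Int.natAbs_mul, Int.natAbs_mul]
      gcongr <;> simp [supHeight]
    _ = _ := by ring

theorem exists_coordinate (x : ℤ × ℤ) : ∃ c : ℤ × ℤ →+ ℤ,
    (∀ y, (c y).natAbs ≤ supHeight y) ∧ (c x).natAbs = supHeight x ∧
      ∀ y, planeDet x y = 0 → c x • y = c y • x := by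
  rcases le_total x.1.natAbs x.2.natAbs with h | h
  · refine ⟨AddMonoidHom.snd ℤ ℤ, fun y => by simp [supHeight], by simp [supHeight, h], ?_⟩
    intro y hy
    ext
    · simp [planeDet] at hy ⊢; linarith
    · simp [mul_comm]
  · refine ⟨AddMonoidHom.fst ℤ ℤ, fun y => by simp [supHeight], by simp [supHeight, h], ?_⟩
    intro y hy
    ext
    · simp [mul_comm]
    · simp [planeDet] at hy ⊢; linarith

/-- In a lattice, a point parallel to a shortest good point `x`, whose relevant coordinate is
smaller than that of `x`, vanishes. -/
theorem eq_zero_of_parallel_of_minimal {Λ : AddSubgroup (ℤ × ℤ)} {G : ℤ × ℤ → Prop}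
    (hG : ∀ (k : ℤ) x, G (k • x) → G x) {x d : ℤ × ℤ} (hx : x ∈ Λ) (hGx : G x)
    (hmin : ∀ y ∈ Λ, G y → supHeight x ≤ supHeight y) (hd : d ∈ Λ) {c : ℤ × ℤ →+ ℤ}
    (hcx : (c x).natAbs = supHeight x) (hpar : c x • d = c d • x)
    (hlt : (c d).natAbs < supHeight x) : d = 0 := by
  have hx0 : c x ≠ 0 := by
    intro h; rw [← hcx, h] at hlt; simp at hlt
  have hdvd : c x ∣ c d := by
    set h : ℤ := ((Int.gcd (c x) (c d) : ℕ) : ℤ) with hh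
    have hh0 : h ≠ 0 := by
      rw [hh]; exact_mod_cast fun e => hx0 (Int.gcd_eq_zero_iff.mp e).1
    obtain ⟨k, hk⟩ : h ∣ c x := Int.gcd_dvd_left _ _
    set g := Int.gcdA (c x) (c d) • x + Int.gcdB (c x) (c d) • d with hg
    have hgΛ : g ∈ Λ := add_mem (zsmul_mem hx _) (zsmul_mem hd _)
    have hxg : x = k • g := by
      have h1 : c x • g = h • x := by
        rw [hg, smul_add, smul_comm (c x), smul_comm (c x), hpar, ← mul_smul, ← mul_smul,
          ← add_smul, hh, Int.gcd_eq_gcd_ab]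
        congr 1; ring
      rw [hk, mul_smul] at h1
      exact (smul_right_injective (ℤ × ℤ) hh0 h1).symm
    have h2 := hmin g hgΛ (hG k g (hxg ▸ hGx))
    have h3 : supHeight x = k.natAbs * supHeight g := by
      conv_lhs => rw [hxg]
      exact supHeight_zsmul k g
    have h4 : k.natAbs ≤ 1 := by
      by_contra! h
      have : 0 < supHeight g := by omega
      nlinarith
    have h5 : c x ∣ h := by
      rw [← Int.natAbs_dvd_natAbs, hk, Int.natAbs_mul]
      calc _ ∣ h.natAbs * 1 := mul_dvd_mul_left _ (by
            have : k ≠ 0 := by rintro rfl; simp at hk; exact hx0 hk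
            have : k.natAbs = 1 := by omega
            rw [this])
        _ = _ := mul_one _
    exact h5.trans (Int.gcd_dvd_right _ _)
  have hcd : c d = 0 := by
    apply Int.eq_zero_of_dvd_of_natAbs_lt_natAbs hdvd
    rwa [hcx]
  rw [hcd, zero_smul] at hpar
  exact (smul_eq_zero.mp hpar).resolve_left hx0

/-- Counting the good points of height at most `T` of a plane lattice all of whose determinants
are divisible by `q` up to the factor `D`, in terms of a shortest good point `x`. -/
theorem ncard_good_le {Λ : AddSubgroup (ℤ × ℤ)} {G : ℤ × ℤ → Prop}
    (hG : ∀ (k : ℤ) x, G (k • x) → G x) {D q T : ℕ} (hD : 0 < D) (hq : 0 < q)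
    (hdet : ∀ x ∈ Λ, ∀ y ∈ Λ, (q : ℤ) ∣ D * planeDet x y)
    {x : ℤ × ℤ} (hx : x ∈ Λ) (hGx : G x) (hx0 : 0 < supHeight x)
    (hmin : ∀ y ∈ Λ, G y → supHeight x ≤ supHeight y) :
    Set.ncard {y | y ∈ Λ ∧ G y ∧ supHeight y ≤ T} ≤
      (2 * (2 * D * supHeight x * T / q) + 1) * (2 * (T / supHeight x) + 2) := by
  obtain ⟨c, hc, hcx, hpar⟩ := exists_coordinate x
  set r := supHeight x
  have hq' : (q : ℤ) ≠ 0 := by exact_mod_cast hq.ne'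
  let K : ℤ := ((2 * D * r * T / q : ℕ) : ℤ)
  let J : ℤ := ((T / r : ℕ) : ℤ)
  let F : Finset (ℤ × ℤ) := Finset.Icc (-K) K ×ˢ Finset.Icc (-J - 1) J
  let f : ℤ × ℤ → ℤ × ℤ := fun y => (D * planeDet x y / q, c y / r)
  have hF : (F : Set (ℤ × ℤ)).ncard =
      (2 * (2 * D * r * T / q) + 1) * (2 * (T / r) + 2) := by
    rw [Set.ncard_coe_finset, Finset.card_product, Int.card_Icc, Int.card_Icc]
    congr 1 <;> omega
  rw [← hF]
  refine Set.ncard_le_ncard_of_injOn f ?_ ?_ (Finset.finite_toSet F)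
  · rintro y ⟨hy, -, hyT⟩
    have h1 : (D * planeDet x y / q).natAbs ≤ 2 * D * r * T / q := by
      obtain ⟨e, he⟩ := hdet x hx y hy
      rw [he, Int.mul_ediv_cancel_left _ hq', Nat.le_div_iff_mul_le hq, mul_comm]
      calc q * e.natAbs = (q * e : ℤ).natAbs := by rw [Int.natAbs_mul, Int.natAbs_natCast]
        _ = D * (planeDet x y).natAbs := by rw [← he, Int.natAbs_mul, Int.natAbs_natCast]
        _ ≤ D * (2 * r * T) := by
          gcongr
          exact (natAbs_planeDet_le x y).trans (by gcongr)
        _ = _ := by ring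
    have h2 : (c y).natAbs ≤ T := (hc y).trans hyT
    have hr : (0 : ℤ) < r := by exact_mod_cast hx0
    have h3 : c y / r ≤ J := by
      simp only [J, Int.natCast_ediv]
      exact Int.ediv_le_ediv hr (by omega)
    have h4 : -J - 1 ≤ c y / r := by
      rw [Int.le_ediv_iff_mul_le hr]
      have h5 : (T : ℤ) < r * (J + 1) := by
        simp only [J]
        exact_mod_cast Nat.lt_mul_div_succ T hx0
      have h6 : (-J - 1) * r = -(r * (J + 1)) := by ring
      rw [h6]
      omega
    simp only [F, f, Finset.coe_product, Finset.coe_Icc, Set.mem_prod, Set.mem_Icc, K]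
    refine ⟨⟨?_, ?_⟩, h4, h3⟩ <;> omega
  · rintro y ⟨hy, -, -⟩ z ⟨hz, -, -⟩ hyz
    simp only [f, Prod.mk.injEq] at hyz
    obtain ⟨h1, h2⟩ := hyz
    have hd : planeDet x (y - z) = 0 := by
      have h3 := Int.ediv_left_inj (hdet x hx y hy) (hdet x hx z hz) |>.mp h1
      have h4 : planeDet x y = planeDet x z := by
        have : (D : ℤ) ≠ 0 := by exact_mod_cast hD.ne'
        exact mul_left_cancel₀ this h3
      simp only [planeDet, Prod.fst_sub, Prod.snd_sub] at h4 ⊢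
      linarith
    refine sub_eq_zero.mp (eq_zero_of_parallel_of_minimal hG hx hGx hmin (sub_mem hy hz) hcx
      (hpar _ hd) ?_)
    have hr : (0 : ℤ) < r := by exact_mod_cast hx0
    have h5 := Int.mul_ediv_add_emod (c y) r
    have h6 := Int.mul_ediv_add_emod (c z) r
    have h7 := Int.emod_lt_of_pos (c y) hr
    have h8 := Int.emod_lt_of_pos (c z) hr
    have h9 := Int.emod_nonneg (c y) hr.ne'
    have h10 := Int.emod_nonneg (c z) hr.ne'
    rw [h2] at h5
    rw [map_sub]
    show (c y - c z).natAbs < r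
    omega

theorem exists_forall_count_lt_rpow (n C D : ℕ) (hn : 0 < n) (hC : 0 < C) :
    ∃ Q : ℕ, ∀ q : ℕ, Q < q → ∀ T r M : ℕ, (T : ℝ) ≤ (q : ℝ) ^ (1 / 2 + 1 / (8 * n) : ℝ) →
      0 < r → r ≤ T → q ≤ C * r ^ n →
      M ≤ (2 * (2 * D * r * T / q) + 1) * (2 * (T / r) + 2) →
      (M : ℝ) < (q : ℝ) ^ (1 / 2 - 1 / (8 * n) : ℝ) := by
  have hn1 : (1 : ℝ) ≤ n := by exact_mod_cast hn
  obtain ⟨δ, hδ⟩ : ∃ δ : ℝ, δ = 1 / (8 * n) := ⟨_, rfl⟩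
  have hδ0 : 0 < δ := by rw [hδ]; positivity
  have hδ8 : δ ≤ 1 / 8 := by
    rw [hδ]; apply one_div_le_one_div_of_le <;> linarith
  have hnδ : (1 : ℝ) / n = 8 * δ := by rw [hδ]; field_simp
  rw [← hδ]
  have hev := ((tendsto_rpow_atTop hδ0).comp tendsto_natCast_atTop_atTop).eventually_gt_atTop
    (16 * D + 2 * C + 2 : ℝ)
  obtain ⟨Q, hQ⟩ := Filter.eventually_atTop.mp hev
  refine ⟨Q, fun q hq T r M hT hr hrT hqr hM => ?_⟩
  have hlarge : (16 * D + 2 * C + 2 : ℝ) < (q : ℝ) ^ δ := hQ q hq.le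
  have hq0 : (0 : ℝ) < q := by exact_mod_cast (Nat.zero_le Q).trans_lt hq
  have hq1 : (1 : ℝ) ≤ q := by exact_mod_cast (Nat.zero_le Q).trans_lt hq
  have hr0 : (0 : ℝ) < r := by exact_mod_cast hr
  have hrT' : (r : ℝ) ≤ T := by exact_mod_cast hrT
  set E : ℝ := (q : ℝ) ^ (1 / 2 - 2 * δ)
  have hE1 : 1 ≤ E := Real.one_le_rpow hq1 (by linarith)
  have hTq : (T : ℝ) ^ 2 / q ≤ E := by
    calc (T : ℝ) ^ 2 / q ≤ ((q : ℝ) ^ (1 / 2 + δ)) ^ 2 / q := by gcongr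
      _ = (q : ℝ) ^ (2 * δ) := by
        rw [← Real.rpow_natCast, ← Real.rpow_mul hq0.le]
        nth_rewrite 2 [← Real.rpow_one (q : ℝ)]
        rw [← Real.rpow_sub hq0]
        congr 1; push_cast; ring
      _ ≤ E := Real.rpow_le_rpow_of_exponent_le hq1 (by linarith)
  have hqr' : (q : ℝ) ^ (8 * δ) ≤ C * r := by
    have hC1 : (1 : ℝ) ≤ C := by exact_mod_cast hC
    calc (q : ℝ) ^ (8 * δ) ≤ ((C * r : ℝ) ^ n) ^ (8 * δ) := by
          refine Real.rpow_le_rpow hq0.le ?_ (by linarith)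
          calc (q : ℝ) ≤ C * r ^ n := by exact_mod_cast hqr
            _ ≤ C ^ n * r ^ n := by gcongr; exact le_self_pow₀ hC1 hn.ne'
            _ = _ := (mul_pow _ _ _).symm
      _ = C * r := by
        rw [← hnδ, one_div, Real.pow_rpow_inv_natCast (by positivity) hn.ne']
  have hTr : (T : ℝ) / r ≤ C * E := by
    rw [div_le_iff₀ hr0]
    calc (T : ℝ) ≤ (q : ℝ) ^ (1 / 2 + δ) := hT
      _ ≤ (q : ℝ) ^ ((1 / 2 - 2 * δ) + 8 * δ) :=
        Real.rpow_le_rpow_of_exponent_le hq1 (by linarith)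
      _ = E * (q : ℝ) ^ (8 * δ) := Real.rpow_add hq0 _ _
      _ ≤ E * (C * r) := by gcongr
      _ = _ := by ring
  have hM' : (M : ℝ) ≤ (2 * (2 * D * r * T / q) + 1) * (2 * (T / r) + 2) := by
    calc (M : ℝ) ≤ ((2 * (2 * D * r * T / q) + 1) * (2 * (T / r) + 2) : ℕ) := by
          exact_mod_cast hM
      _ ≤ _ := by
        push_cast
        gcongr
        · exact Nat.cast_div_le.trans_eq (by push_cast; rfl)
        · exact Nat.cast_div_le
  calc (M : ℝ) ≤ (2 * (2 * D * r * T / q) + 1) * (2 * (T / r) + 2) := hM'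
    _ = 8 * D * (T ^ 2 / q) + 8 * D * (r * T / q) + 2 * (T / r) + 2 := by field_simp; ring
    _ ≤ 8 * D * (T ^ 2 / q) + 8 * D * (T ^ 2 / q) + 2 * (T / r) + 2 := by
      rw [sq]; gcongr
    _ ≤ 8 * D * E + 8 * D * E + 2 * (C * E) + 2 * E := by gcongr; linarith
    _ = (16 * D + 2 * C + 2) * E := by ring
    _ < (q : ℝ) ^ δ * E := by gcongr
    _ = (q : ℝ) ^ (1 / 2 - δ) := by
      rw [← Real.rpow_add hq0]; congr 1; ring

/-- The lattice of pairs `(u, v)` with `uβ_p − vα_p ∈ qℤ_p` for every `p ∈ P`. -/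
def congruenceLattice (P : Finset Nat.Primes) (α β : (p : Nat.Primes) → ℤ_[(p : ℕ)]) (q : ℕ) :
    AddSubgroup (ℤ × ℤ) where
  carrier := {x | ∀ p ∈ P, (q : ℤ_[(p : ℕ)]) ∣ (x.1 : ℤ_[(p : ℕ)]) * β p - x.2 * α p}
  zero_mem' p _ := by simp
  add_mem' {x y} hx hy p hp := by
    have h := dvd_add (hx p hp) (hy p hp)
    convert h using 1
    push_cast [Prod.fst_add, Prod.snd_add]
    ring
  neg_mem' {x} hx p hp := by
    have h := (dvd_neg (b := (x.1 : ℤ_[(p : ℕ)]) * β p - x.2 * α p)).mpr (hx p hp)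
    convert h using 1
    push_cast [Prod.fst_neg, Prod.snd_neg]
    ring

theorem exists_dvd_mul_planeDet {P : Finset Nat.Primes} {α β : (p : Nat.Primes) → ℤ_[(p : ℕ)]}
    (hne : ∀ p ∈ P, ¬ (α p = 0 ∧ β p = 0)) :
    ∃ D : ℕ, 0 < D ∧ ∀ q : ℕ, (∀ l : Nat.Primes, (l : ℕ) ∣ q → l ∈ P) →
      ∀ x ∈ congruenceLattice P α β q, ∀ y ∈ congruenceLattice P α β q,
        (q : ℤ) ∣ D * planeDet x y := by
  have hloc (p : Nat.Primes) : ∃ D : ℕ, 0 < D ∧ (p ∈ P →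
      α p ∣ (D : ℤ_[(p : ℕ)]) ∨ β p ∣ (D : ℤ_[(p : ℕ)])) := by
    by_cases hp : p ∈ P
    · by_cases hα : α p = 0
      · obtain ⟨D, hD, h⟩ := PadicInt.exists_pos_dvd_natCast fun hβ => hne p hp ⟨hα, hβ⟩
        exact ⟨D, hD, fun _ => .inr h⟩
      · obtain ⟨D, hD, h⟩ := PadicInt.exists_pos_dvd_natCast hα
        exact ⟨D, hD, fun _ => .inl h⟩
    · exact ⟨1, one_pos, fun h => absurd h hp⟩
  choose D hD0 hD using hloc
  refine ⟨∏ p ∈ P, D p, Finset.prod_pos fun p _ => hD0 p, fun q hq x hx y hy => ?_⟩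
  refine Int.natCast_dvd_of_forall_padicInt_dvd hq fun p hp => ?_
  have h1 : (D p : ℤ_[(p : ℕ)]) ∣ ((∏ p ∈ P, D p : ℕ) : ℤ_[(p : ℕ)]) :=
    Nat.cast_dvd_cast (Finset.dvd_prod_of_mem D hp)
  have hα : (q : ℤ_[(p : ℕ)]) ∣ α p * planeDet x y := by
    convert dvd_sub ((hx p hp).mul_left (y.1 : ℤ_[(p : ℕ)]))
      ((hy p hp).mul_left (x.1 : ℤ_[(p : ℕ)])) using 1
    simp only [planeDet]; push_cast; ring
  have hβ : (q : ℤ_[(p : ℕ)]) ∣ β p * planeDet x y := by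
    convert dvd_sub ((hx p hp).mul_left (y.2 : ℤ_[(p : ℕ)]))
      ((hy p hp).mul_left (x.2 : ℤ_[(p : ℕ)])) using 1
    simp only [planeDet]; push_cast; ring
  rw [Int.cast_mul, Int.cast_natCast]
  rcases hD p hp with h | h
  · exact hα.trans (mul_dvd_mul_right (h.trans h1) _)
  · exact hβ.trans (mul_dvd_mul_right (h.trans h1) _)

theorem exists_le_mul_supHeight_pow {P : Finset Nat.Primes}
    {α β : (p : Nat.Primes) → ℤ_[(p : ℕ)]}
    (halg : ∀ p ∈ P, IsAlgebraic ℤ (α p) ∧ IsAlgebraic ℤ (β p)) :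
    ∃ n C : ℕ, ∀ q : ℕ, (∀ l : Nat.Primes, (l : ℕ) ∣ q → l ∈ P) →
      ∀ x ∈ congruenceLattice P α β q,
        (∀ p ∈ P, (x.1 : ℤ_[(p : ℕ)]) * β p - x.2 * α p ≠ 0) → q ≤ C * supHeight x ^ n := by
  have hloc (p : Nat.Primes) : ∃ n C : ℕ, p ∈ P → ∀ x : ℤ × ℤ,
      (x.1 : ℤ_[(p : ℕ)]) * β p - x.2 * α p ≠ 0 → ∃ N : ℤ, N ≠ 0 ∧
        N.natAbs ≤ C * supHeight x ^ n ∧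
        (x.1 : ℤ_[(p : ℕ)]) * β p - x.2 * α p ∣ (N : ℤ_[(p : ℕ)]) := by
    by_cases hp : p ∈ P
    · obtain ⟨n, C, h⟩ := exists_liouville_norm (halg p hp).1 (halg p hp).2
      exact ⟨n, C, fun _ x hx => h x.1 x.2 _ (le_max_left _ _) (le_max_right _ _) hx⟩
    · exact ⟨0, 0, fun h => absurd h hp⟩
  choose n C h using hloc
  refine ⟨∑ p ∈ P, n p, ∏ p ∈ P, C p, fun q hq x hx hG => ?_⟩
  have hN (p : Nat.Primes) : ∃ N : ℤ, p ∈ P → N ≠ 0 ∧ N.natAbs ≤ C p * supHeight x ^ n p ∧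
      (x.1 : ℤ_[(p : ℕ)]) * β p - x.2 * α p ∣ (N : ℤ_[(p : ℕ)]) := by
    by_cases hp : p ∈ P
    · obtain ⟨N, hN⟩ := h p hp x (hG p hp)
      exact ⟨N, fun _ => hN⟩
    · exact ⟨0, fun h => absurd h hp⟩
  choose N hN using hN
  have hdvd : (q : ℤ) ∣ ∏ p ∈ P, N p :=
    Int.natCast_dvd_of_forall_padicInt_dvd hq fun p hp =>
      ((hx p hp).trans (hN p hp).2.2).trans (Int.cast_dvd_cast _ _ (Finset.dvd_prod_of_mem N hp))
  have hprod : ∏ p ∈ P, N p ≠ 0 := Finset.prod_ne_zero_iff.mpr fun p hp => (hN p hp).1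
  calc q ≤ (∏ p ∈ P, N p).natAbs :=
        Nat.le_of_dvd (Int.natAbs_pos.mpr hprod) (Int.natCast_dvd.mp hdvd)
    _ = ∏ p ∈ P, (N p).natAbs := map_prod Int.natAbsHom N P
    _ ≤ ∏ p ∈ P, C p * supHeight x ^ n p :=
      Finset.prod_le_prod' fun p hp => (hN p hp).2.1
    _ = _ := by rw [Finset.prod_mul_distrib, Finset.prod_pow_eq_pow_sum]

/-- Let `P` be a finite set of primes and, for each `p ∈ P`, let
`α_p, β_p ∈ ℤ_p` be algebraic over `ℚ` and not both zero.  There are constants `d > 1/2`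
and `s < 1/2` and a bound `Q` such that `M(q, q^d) < q^s` for all `q > Q` whose prime
factors all lie in `P`. -/
theorem Mcount_lt_eventually
    (P : Finset Nat.Primes) (α β : (p : Nat.Primes) → ℤ_[(p : ℕ)])
    (halg : ∀ p ∈ P, IsAlgebraic ℤ (α p) ∧ IsAlgebraic ℤ (β p))
    (hne : ∀ p ∈ P, ¬ (α p = 0 ∧ β p = 0)) :
    ∃ d s : ℝ, 1 / 2 < d ∧ s < 1 / 2 ∧
      ∃ Q : ℕ, ∀ q : ℕ, Q < q → (∀ l : Nat.Primes, (l : ℕ) ∣ q → l ∈ P) →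
        (Mcount P α β q ((q : ℝ) ^ d) : ℝ) < (q : ℝ) ^ s := by
  obtain ⟨D, hD, hdet⟩ := exists_dvd_mul_planeDet hne
  obtain ⟨n, C, hLiouville⟩ := exists_le_mul_supHeight_pow halg
  obtain ⟨Q, hQ⟩ := exists_forall_count_lt_rpow (n + 1) (C + 1) D n.succ_pos C.succ_pos
  refine ⟨1 / 2 + 1 / (8 * (n + 1 : ℕ)), 1 / 2 - 1 / (8 * (n + 1 : ℕ)),
    lt_add_of_pos_right _ (by positivity), sub_lt_self _ (by positivity), max Q 1, ?_⟩
  intro q hq hqP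
  have hqQ : Q < q := (le_max_left _ _).trans_lt hq
  have hq1 : 1 < q := (le_max_right _ _).trans_lt hq
  set t : ℝ := (q : ℝ) ^ (1 / 2 + 1 / (8 * (n + 1 : ℕ)) : ℝ)
  have ht : 0 ≤ t := Real.rpow_nonneg (Nat.cast_nonneg q) _
  let G : ℤ × ℤ → Prop := fun x => ∀ p ∈ P, (x.1 : ℤ_[(p : ℕ)]) * β p - x.2 * α p ≠ 0
  have hG (k : ℤ) (x : ℤ × ℤ) (h : G (k • x)) : G x := by
    intro p hp h0
    apply h p hp
    rw [Prod.smul_fst, Prod.smul_snd, smul_eq_mul, smul_eq_mul, Int.cast_mul, Int.cast_mul,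
      mul_assoc, mul_assoc, ← mul_sub, h0, mul_zero]
  have hGpos {x : ℤ × ℤ} (h : G x) : 0 < supHeight x := by
    obtain ⟨l, hl, hlq⟩ := Nat.exists_prime_and_dvd hq1.ne'
    rw [Nat.pos_iff_ne_zero]
    intro h0
    have h1 : x.1.natAbs ≤ 0 := h0 ▸ le_max_left _ _
    have h2 : x.2.natAbs ≤ 0 := h0 ▸ le_max_right _ _
    apply h ⟨l, hl⟩ (hqP ⟨l, hl⟩ hlq)
    rw [Int.natAbs_eq_zero.mp (Nat.le_zero.mp h1), Int.natAbs_eq_zero.mp (Nat.le_zero.mp h2)]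
    simp
  have hcount : Mcount P α β q t =
      Set.ncard {y | y ∈ congruenceLattice P α β q ∧ G y ∧ supHeight y ≤ ⌊t⌋₊} := by
    have habs (u : ℤ) : (|u| : ℝ) ≤ t ↔ u.natAbs ≤ ⌊t⌋₊ := by
      rw [Nat.le_floor_iff ht, Nat.cast_natAbs, Int.cast_abs]
    unfold Mcount
    congr 1
    ext x
    simp only [Set.mem_ofPred_eq, habs, supHeight, max_le_iff]
    rfl
  rw [hcount]
  rcases Set.eq_empty_or_nonempty
    {y | y ∈ congruenceLattice P α β q ∧ G y ∧ supHeight y ≤ ⌊t⌋₊} with hS | ⟨y, hy, hGy, hyT⟩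
  · rw [hS, Set.ncard_empty, Nat.cast_zero]
    exact Real.rpow_pos_of_pos (by exact_mod_cast one_pos.trans hq1) _
  obtain ⟨x, ⟨hx, hGx⟩, hmin⟩ := exists_minimalFor_of_wellFoundedLT
    (fun z => z ∈ congruenceLattice P α β q ∧ G z) supHeight ⟨y, hy, hGy⟩
  have hmin' (z) (hz : z ∈ congruenceLattice P α β q) (hGz : G z) :
      supHeight x ≤ supHeight z := by
    by_contra! h
    exact h.not_ge (hmin ⟨hz, hGz⟩ h.le)
  refine hQ q hqQ ⌊t⌋₊ (supHeight x) _ (Nat.floor_le ht) (hGpos hGx)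
    ((hmin' y hy hGy).trans hyT) ?_
    (ncard_good_le hG hD (one_pos.trans hq1) (hdet q hqP) hx hGx (hGpos hGx) hmin')
  calc q ≤ C * supHeight x ^ n := hLiouville q hqP x hx hGx
    _ ≤ (C + 1) * supHeight x ^ (n + 1) := by
      have := hGpos hGx
      gcongr <;> omega
end

section
/- Let m be a positive integer and χ a nontrivial Dirichlet character modulo m with complex values. Then the series ∑_{n=1}^∞ χ(n)(log n)/n converges, and lim_{x→∞} ∑_{n=1}^∞ χ(n)(log n) n^{−1} e^{−n²/x} = ∑_{n=1}^∞ χ(n)(log n)/n = −L′(1, χ), the negative of the derivative at s = 1 of the Dirichlet L-function of χ; the limit is taken as the real number x tends to infinity. -/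
open Filter

section AbelSummation

variable {E : Type*} [NormedAddCommGroup E] [NormedSpace ℝ E]

lemma norm_sum_range_smul_le_of_antitone {w : ℕ → ℝ} {b : ℕ → E} {ε : ℝ} (hw : Antitone w)
    (hw0 : ∀ n, 0 ≤ w n) (hb : ∀ k, ‖∑ i ∈ Finset.range k, b i‖ ≤ ε) (M : ℕ) :
    ‖∑ i ∈ Finset.range M, w i • b i‖ ≤ w 0 * ε := by
  have key : ∑ i ∈ Finset.range M, w i • b i = w M • ∑ i ∈ Finset.range M, b i +
      ∑ i ∈ Finset.range M, (w i - w (i + 1)) • ∑ j ∈ Finset.range (i + 1), b j := by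
    induction M with
    | zero => simp
    | succ M ih =>
      rw [Finset.sum_range_succ, ih, Finset.sum_range_succ (fun i ↦ (w i - w (i + 1)) • _),
        Finset.sum_range_succ b M]
      module
  rw [key]
  calc _ ≤ w M * ε + ∑ i ∈ Finset.range M, (w i - w (i + 1)) * ε := by
        refine (norm_add_le _ _).trans (add_le_add ?_ (norm_sum_le_of_le _ fun i _ ↦ ?_))
        · rw [norm_smul, Real.norm_of_nonneg (hw0 M)]
          exact mul_le_mul_of_nonneg_left (hb M) (hw0 M)
        · have hi : 0 ≤ w i - w (i + 1) := sub_nonneg.2 (hw i.le_succ)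
          rw [norm_smul, Real.norm_of_nonneg hi]
          exact mul_le_mul_of_nonneg_left (hb _) hi
    _ = w 0 * ε := by
        rw [← Finset.sum_mul, Finset.sum_range_sub']
        ring

/-- A convergent series is summed to its value by any family of summability weights that are
antitone with values in `[0, 1]` and tend pointwise to `1`. -/
lemma tendsto_tsum_smul_of_antitone {ι : Type*} {l : Filter ι} {a : ℕ → E} {L : E}
    {w : ι → ℕ → ℝ} (ha : Tendsto (fun N ↦ ∑ i ∈ Finset.range N, a i) atTop (nhds L))
    (hw : ∀ᶠ t in l, Antitone (w t)) (hw0 : ∀ᶠ t in l, ∀ n, 0 ≤ w t n)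
    (hw1 : ∀ᶠ t in l, w t 0 ≤ 1) (hlim : ∀ n, Tendsto (fun t ↦ w t n) l (nhds 1))
    (hs : ∀ᶠ t in l, Summable fun n ↦ w t n • a n) :
    Tendsto (fun t ↦ ∑' n, w t n • a n) l (nhds L) := by
  rw [Metric.tendsto_nhds]
  intro ε hε
  obtain ⟨N, hN⟩ := Metric.tendsto_atTop.1 ha (ε / 5) (by positivity)
  have hfin : Tendsto (fun t ↦ ∑ i ∈ Finset.range N, w t i • a i) l
      (nhds (∑ i ∈ Finset.range N, a i)) := by
    refine tendsto_finsetSum _ fun i _ ↦ ?_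
    simpa using (hlim i).smul_const (a i)
  filter_upwards [hw, hw0, hw1, hs, Metric.tendsto_nhds.1 hfin (ε / 5) (by positivity)]
    with t ht ht0 ht1 hst hNt
  have htail : ‖∑' n, w t (n + N) • a (n + N)‖ ≤ 2 * (ε / 5) := by
    refine le_of_tendsto
      ((summable_nat_add_iff N).2 hst).hasSum.tendsto_sum_nat.norm (Eventually.of_forall fun M ↦ ?_)
    refine (norm_sum_range_smul_le_of_antitone (w := fun n ↦ w t (n + N))
      (b := fun n ↦ a (n + N)) (ε := 2 * (ε / 5)) (fun i j hij ↦ ht (by omega))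
      (fun n ↦ ht0 _) (fun k ↦ ?_) M).trans ?_
    · have h : ∑ i ∈ Finset.range k, a (i + N) =
          ∑ i ∈ Finset.range (N + k), a i - ∑ i ∈ Finset.range N, a i := by
        rw [Finset.sum_range_add, add_sub_cancel_left]
        simp_rw [add_comm N]
      rw [h, ← dist_eq_norm]
      linarith [dist_triangle_right (∑ i ∈ Finset.range (N + k), a i)
        (∑ i ∈ Finset.range N, a i) L, hN N le_rfl, hN (N + k) (by omega)]
    · exact mul_le_of_le_one_left (by positivity) ((ht (Nat.zero_le _)).trans ht1)
  rw [← hst.sum_add_tsum_nat_add N]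
  have h1 := dist_triangle4 (∑ i ∈ Finset.range N, w t i • a i + ∑' n, w t (n + N) • a (n + N))
    (∑ i ∈ Finset.range N, w t i • a i) (∑ i ∈ Finset.range N, a i) L
  rw [dist_self_add_left] at h1
  linarith [hN N le_rfl]

end AbelSummation

namespace DirichletCharacter

variable {m : ℕ} {χ : DirichletCharacter ℂ m}

lemma summable_log_div_mul_exp {x : ℝ} (hx : 0 < x) :
    Summable fun n : ℕ ↦ χ (n : ZMod m) * (Real.log n : ℂ) / (n : ℂ) *
      Real.exp (-(n : ℝ) ^ 2 / x) := by
  have hgeom : Summable fun n : ℕ ↦ Real.exp (-1 / x) ^ n :=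
    summable_geometric_of_lt_one (Real.exp_pos _).le
      (Real.exp_lt_one_iff.2 (div_neg_of_neg_of_pos (by norm_num) hx))
  refine hgeom.of_norm_bounded fun n ↦ ?_
  rw [norm_mul, norm_div, norm_mul, Complex.norm_real, Complex.norm_real, Complex.norm_natCast,
    Real.norm_of_nonneg (Real.exp_pos _).le, Real.norm_of_nonneg (Real.log_natCast_nonneg n),
    ← Real.exp_nat_mul]
  have hn : (n : ℝ) ≤ (n : ℝ) ^ 2 := by exact_mod_cast Nat.le_self_pow two_ne_zero n
  have h1 : ‖χ (n : ZMod m)‖ * Real.log n / n ≤ 1 := by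
    refine div_le_one_of_le₀ ?_ n.cast_nonneg
    exact (mul_le_of_le_one_left (Real.log_natCast_nonneg n) (χ.norm_le_one _)).trans
      (Real.log_le_self n.cast_nonneg)
  refine (mul_le_of_le_one_left (Real.exp_pos _).le h1).trans (Real.exp_le_exp.2 ?_)
  rw [mul_div_assoc']
  gcongr
  linarith

variable [NeZero m]

lemma norm_sum_range_le (hχ : χ ≠ 1) (n : ℕ) :
    ‖∑ i ∈ Finset.range n, χ (i : ZMod m)‖ ≤ m := by
  have hm : ∑ i ∈ Finset.range m, χ (i : ZMod m) = 0 := by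
    rw [← MulChar.sum_eq_zero_of_ne_one hχ]
    refine Finset.sum_bij (fun i _ ↦ (i : ZMod m)) (fun _ _ ↦ Finset.mem_univ _) ?_ ?_
      (fun _ _ ↦ rfl)
    · intro i hi j hj hij
      rw [Finset.mem_range] at hi hj
      simpa [ZMod.val_cast_of_lt hi, ZMod.val_cast_of_lt hj] using congrArg ZMod.val hij
    · exact fun b _ ↦ ⟨b.val, Finset.mem_range.2 (ZMod.val_lt b), ZMod.natCast_zmod_val b⟩
  have hper : Function.Periodic (fun n ↦ ∑ i ∈ Finset.range n, χ (i : ZMod m)) m := by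
    intro n
    induction n with
    | zero => simpa using hm
    | succ n ih =>
      simp only at ih ⊢
      rw [add_right_comm, Finset.sum_range_succ, ih, Finset.sum_range_succ]
      simp
  rw [← hper.map_mod_nat n]
  refine (norm_sum_le_of_le (f := fun i : ℕ ↦ χ (i : ZMod m)) _
    fun i _ ↦ χ.norm_le_one (i : ZMod m)).trans ?_
  simpa using (Nat.mod_lt n (NeZero.pos m)).le

lemma exists_tendsto_sum_log_div (hχ : χ ≠ 1) :
    ∃ L : ℂ, Tendsto (fun N : ℕ ↦ ∑ n ∈ Finset.range N,
      χ (n : ZMod m) * (Real.log n : ℂ) / (n : ℂ)) atTop (nhds L) := by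
  let f : ℕ → ℝ := fun n ↦ Real.log (n + 3 : ℕ) / (n + 3 : ℕ)
  have hf : Antitone f := by
    intro i j hij
    have h3 (k : ℕ) : Real.exp 1 ≤ ((k + 3 : ℕ) : ℝ) := by
      push_cast
      linarith [Real.exp_one_lt_d9, (Nat.cast_nonneg k : (0 : ℝ) ≤ k)]
    exact Real.log_div_self_antitoneOn (h3 i) (h3 j) (by exact_mod_cast Nat.add_le_add_right hij 3)
  have hf0 : Tendsto f atTop (nhds 0) :=
    (Real.isLittleO_log_id_atTop.tendsto_div_nhds_zero.comp tendsto_natCast_atTop_atTop).comp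
      (tendsto_add_atTop_nat 3)
  have hz (n : ℕ) : ‖∑ i ∈ Finset.range n, χ ((i + 3 : ℕ) : ZMod m)‖ ≤ m + m := by
    have h : ∑ i ∈ Finset.range n, χ ((i + 3 : ℕ) : ZMod m) =
        ∑ i ∈ Finset.range (3 + n), χ (i : ZMod m) - ∑ i ∈ Finset.range 3, χ (i : ZMod m) := by
      rw [Finset.sum_range_add, add_sub_cancel_left]
      simp_rw [add_comm 3]
    rw [h]
    exact (norm_sub_le _ _).trans (add_le_add (norm_sum_range_le hχ _) (norm_sum_range_le hχ _))
  obtain ⟨L, hL⟩ := cauchySeq_tendsto_of_complete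
    (hf.cauchySeq_series_mul_of_tendsto_zero_of_bounded hf0 hz)
  refine ⟨∑ n ∈ Finset.range 3, χ (n : ZMod m) * (Real.log n : ℂ) / (n : ℂ) + L, ?_⟩
  rw [← tendsto_add_atTop_iff_nat 3]
  refine (hL.const_add _).congr fun N ↦ ?_
  rw [add_comm N, Finset.sum_range_add _ 3]
  congr 1
  refine Finset.sum_congr rfl fun i _ ↦ ?_
  simp only [f, Complex.real_smul, add_comm 3 i]
  push_cast
  ring

lemma summable_and_tsum_log_div_rpow_eq_neg_deriv_LFunction {s : ℝ} (hs : 1 < s) :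
    (Summable fun n : ℕ ↦ ((n + 1 : ℕ) : ℝ) ^ (1 - s) •
      (χ ((n + 1 : ℕ) : ZMod m) * (Real.log (n + 1 : ℕ) : ℂ) / ((n + 1 : ℕ) : ℂ))) ∧
    ∑' n : ℕ, ((n + 1 : ℕ) : ℝ) ^ (1 - s) •
      (χ ((n + 1 : ℕ) : ZMod m) * (Real.log (n + 1 : ℕ) : ℂ) / ((n + 1 : ℕ) : ℂ)) =
      -deriv (LFunction χ) s := by
  have hs' : 1 < (s : ℂ).re := by simpa
  have habs : LSeries.abscissaOfAbsConv (fun n : ℕ ↦ χ n) < (s : ℂ).re := by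
    rw [absicssaOfAbsConv_eq_one (NeZero.ne m)]
    exact_mod_cast hs
  have hsum := LSeriesSummable_logMul_of_lt_re habs
  have hterm (n : ℕ) : ((n + 1 : ℕ) : ℝ) ^ (1 - s) •
      (χ ((n + 1 : ℕ) : ZMod m) * (Real.log (n + 1 : ℕ) : ℂ) / ((n + 1 : ℕ) : ℂ)) =
      LSeries.term (LSeries.logMul fun n : ℕ ↦ χ n) s (n + 1) := by
    have hpos : (0 : ℝ) < ((n + 1 : ℕ) : ℝ) := by positivity
    have hne : ((n + 1 : ℕ) : ℂ) ≠ 0 := Nat.cast_ne_zero.2 n.succ_ne_zero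
    rw [LSeries.term_of_ne_zero n.succ_ne_zero, LSeries.logMul, Complex.real_smul,
      Complex.ofReal_cpow hpos.le, Complex.ofReal_log hpos.le, Complex.ofReal_natCast,
      Complex.ofReal_sub, Complex.ofReal_one, Complex.cpow_sub _ _ hne, Complex.cpow_one]
    field_simp
  simp_rw [hterm]
  refine ⟨(summable_nat_add_iff 1).2 hsum, ?_⟩
  rw [deriv_LFunction_eq_deriv_LSeries χ hs', LSeries_deriv habs, neg_neg, LSeries,
    hsum.tsum_eq_zero_add, LSeries.term_zero, zero_add]

end DirichletCharacter

/-- Let `χ` be a nontrivial Dirichlet character mod `m`.  Then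
`∑ χ(n)(log n)/n` converges, and
`∑_{n≥1} χ(n)(log n) n⁻¹ e^{−n²/x} → ∑ χ(n)(log n)/n = −L′(1, χ)` as the real
number `x → ∞`. -/
theorem abel_limit_L_deriv_one (m : ℕ) [NeZero m] (χ : DirichletCharacter ℂ m)
    (hχ : χ ≠ 1) :
    ∃ L : ℂ,
      Tendsto (fun N : ℕ => ∑ n ∈ Finset.Icc 1 N,
          χ (n : ZMod m) * (Real.log n : ℂ) / (n : ℂ))
        atTop (nhds L) ∧
      L = -(deriv (DirichletCharacter.LFunction χ) 1) ∧
      Tendsto (fun x : ℝ =>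
          ∑' n : ℕ, χ (n : ZMod m) * (Real.log n : ℂ) / (n : ℂ)
            * Real.exp (-(n : ℝ) ^ 2 / x))
        atTop (nhds L) := by
  obtain ⟨L, hL⟩ := DirichletCharacter.exists_tendsto_sum_log_div hχ
  have hshift : Tendsto (fun N : ℕ ↦ ∑ n ∈ Finset.range N, χ ((n + 1 : ℕ) : ZMod m) *
      (Real.log (n + 1 : ℕ) : ℂ) / ((n + 1 : ℕ) : ℂ)) atTop (nhds L) := by
    refine (hL.comp (tendsto_add_atTop_nat 1)).congr fun N ↦ ?_
    rw [Function.comp_apply, Finset.sum_range_succ']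
    simp only [Nat.cast_zero, div_zero, add_zero]
  refine ⟨L, hshift.congr fun N ↦ ?_, ?_, ?_⟩
  · rw [Finset.range_eq_Ico, Finset.sum_Ico_add' (fun n : ℕ ↦
      χ (n : ZMod m) * (Real.log n : ℂ) / (n : ℂ)), zero_add]
    rfl
  · have hdirichlet := tendsto_tsum_smul_of_antitone (l := nhdsWithin (1 : ℝ) (Set.Ioi 1))
      (w := fun s n ↦ ((n + 1 : ℕ) : ℝ) ^ (1 - s)) hshift
      (by
        filter_upwards [self_mem_nhdsWithin] with s hs i j hij
        refine Real.rpow_le_rpow_of_nonpos (by positivity) (by gcongr) ?_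
        linarith [Set.mem_Ioi.1 hs])
      (Eventually.of_forall fun s n ↦ by positivity)
      (Eventually.of_forall fun s ↦ by simp)
      (fun n ↦ by
        have h : Continuous fun s : ℝ ↦ ((n + 1 : ℕ) : ℝ) ^ (1 - s) :=
          Continuous.rpow continuous_const (by fun_prop)
            fun s ↦ Or.inl (Nat.cast_ne_zero.2 n.succ_ne_zero)
        simpa using (h.tendsto 1).mono_left nhdsWithin_le_nhds)
      (by
        filter_upwards [self_mem_nhdsWithin] with s hs
        exact (DirichletCharacter.summable_and_tsum_log_div_rpow_eq_neg_deriv_LFunction hs).1)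
    have hcont : Continuous fun s : ℝ ↦ -deriv (DirichletCharacter.LFunction χ) s :=
      (((DirichletCharacter.differentiable_LFunction hχ).contDiff.continuous_deriv
        (n := 1) le_rfl).comp Complex.continuous_ofReal).neg
    have hderiv := (hcont.tendsto 1).mono_left (nhdsWithin_le_nhds (s := Set.Ioi 1))
    rw [Complex.ofReal_one] at hderiv
    refine tendsto_nhds_unique hdirichlet (hderiv.congr' ?_)
    filter_upwards [self_mem_nhdsWithin] with s hs
    exact (DirichletCharacter.summable_and_tsum_log_div_rpow_eq_neg_deriv_LFunction hs).2.symm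
  · have hcomm (x : ℝ) (n : ℕ) : Real.exp (-((n + 1 : ℕ) : ℝ) ^ 2 / x) •
        (χ ((n + 1 : ℕ) : ZMod m) * (Real.log (n + 1 : ℕ) : ℂ) / ((n + 1 : ℕ) : ℂ)) =
        χ ((n + 1 : ℕ) : ZMod m) * (Real.log (n + 1 : ℕ) : ℂ) / ((n + 1 : ℕ) : ℂ) *
          Real.exp (-((n + 1 : ℕ) : ℝ) ^ 2 / x) := by
      rw [Complex.real_smul, mul_comm]
    have hgauss := tendsto_tsum_smul_of_antitone (l := (atTop : Filter ℝ))
      (w := fun x n ↦ Real.exp (-((n + 1 : ℕ) : ℝ) ^ 2 / x)) hshift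
      (by
        filter_upwards [eventually_gt_atTop 0] with x hx i j hij
        dsimp only
        gcongr)
      (Eventually.of_forall fun x n ↦ (Real.exp_pos _).le)
      (by
        filter_upwards [eventually_gt_atTop 0] with x hx
        refine Real.exp_le_one_iff.2 (div_nonpos_of_nonpos_of_nonneg ?_ hx.le)
        simp)
      (fun n ↦ by
        have h : Tendsto (fun x : ℝ ↦ -((n + 1 : ℕ) : ℝ) ^ 2 / x) atTop (nhds 0) :=
          tendsto_const_nhds.div_atTop tendsto_id
        simpa [Function.comp_def] using (Real.continuous_exp.tendsto 0).comp h)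
      (by
        filter_upwards [eventually_gt_atTop 0] with x hx
        simp_rw [hcomm]
        exact (summable_nat_add_iff 1).2 (DirichletCharacter.summable_log_div_mul_exp hx))
    refine hgauss.congr' ?_
    filter_upwards [eventually_gt_atTop 0] with x hx
    rw [(DirichletCharacter.summable_log_div_mul_exp hx).tsum_eq_zero_add]
    simp_rw [hcomm]
    simp
end
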